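/- Let γ ∈ Γ with (γ,γ) = 0 and let β ∈ R with (γ,β) ≠ 0. Then γ+β ∈ R or γ−β ∈ R. -/

import Mathlib

/-- A finite-dimensional Lie superalgebra `g = g₀ ⊕ g₁`: a Lie algebra `g₀`,
a `g₀`-module `g₁` (action `act`), and a symmetric bracket `br : g₁ × g₁ → g₀`
satisfying invariance and the super Jacobi identity. -/
structure LieSuperData (k g0 g1 : Type*) [Field k] [LieRing g0] [LieAlgebra k g0]
    [AddCommGroup g1] [Module k g1] where
  act : g0 →ₗ[k] g1 →ₗ[k] g1
  act_lie : ∀ (x y : g0) (u : g1), act ⁅x, y⁆ u = act x (act y u) - act y (act x u)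
  br : g1 →ₗ[k] g1 →ₗ[k] g0
  br_symm : ∀ u v : g1, br u v = br v u
  br_invariance : ∀ (x : g0) (u v : g1), ⁅x, br u v⁆ = br (act x u) v + br u (act x v)
  super_jacobi : ∀ u v w : g1, act (br u v) w + act (br v w) u + act (br w u) v = 0

/-- A nondegenerate even supersymmetric invariant bilinear form `B = (B₀, B₁)` on a
Lie superalgebra. -/
structure InvForm {k g0 g1 : Type*} [Field k] [LieRing g0] [LieAlgebra k g0]
    [AddCommGroup g1] [Module k g1] (D : LieSuperData k g0 g1) where
  B0 : g0 →ₗ[k] g0 →ₗ[k] k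
  B1 : g1 →ₗ[k] g1 →ₗ[k] k
  B0_symm : ∀ x y : g0, B0 x y = B0 y x
  B0_invariant : ∀ x y z : g0, B0 ⁅x, y⁆ z = B0 x ⁅y, z⁆
  B1_alt : ∀ u v : g1, B1 u v = - B1 v u
  compat : ∀ (x : g0) (u v : g1), B0 x (D.br u v) = B1 (D.act x u) v
  B0_nondeg : ∀ x : g0, (∀ y : g0, B0 x y = 0) → x = 0
  B1_nondeg : ∀ u : g1, (∀ v : g1, B1 u v = 0) → u = 0

/-- The weight space `(g₀)_α = {x ∈ g₀ : ⁅H, x⁆ = α(H) x for all H ∈ t}`. -/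
def evenSpace {k g0 : Type*} [Field k] [LieRing g0] [LieAlgebra k g0]
    (t : LieSubalgebra k g0) (α : Module.Dual k t) : Submodule k g0 where
  carrier := {x | ∀ H : t, ⁅(H : g0), x⁆ = α H • x}
  add_mem' := by
    intro a b ha hb H
    rw [lie_add, ha H, hb H, smul_add]
  zero_mem' := by
    intro H
    rw [lie_zero, smul_zero]
  smul_mem' := by
    intro c x hx H
    rw [lie_smul, hx H, smul_comm]

/-- The weight space `(g₁)_γ = {u ∈ g₁ : H · u = γ(H) u for all H ∈ t}`. -/
def oddSpace {k g0 g1 : Type*} [Field k] [LieRing g0] [LieAlgebra k g0]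
    [AddCommGroup g1] [Module k g1] (D : LieSuperData k g0 g1)
    (t : LieSubalgebra k g0) (γ : Module.Dual k t) : Submodule k g1 where
  carrier := {u | ∀ H : t, D.act (H : g0) u = γ H • u}
  add_mem' := by
    intro a b ha hb H
    rw [map_add, ha H, hb H, smul_add]
  zero_mem' := by
    intro H
    rw [map_zero, smul_zero]
  smul_mem' := by
    intro c u hu H
    rw [map_smul, hu H, smul_comm]

/-- The induced form on weights: `(θ, η) := B₀(H_θ, H_η)`. -/
def pairing {k g0 : Type*} [Field k] [LieRing g0] [LieAlgebra k g0]
    {t : LieSubalgebra k g0} (B0 : g0 →ₗ[k] g0 →ₗ[k] k)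
    (Hd : Module.Dual k t → t) (θ η : Module.Dual k t) : k :=
  B0 (Hd θ : g0) (Hd η : g0)


open Pointwise

section

variable {k g0 g1 : Type*} [Field k] [LieRing g0] [LieAlgebra k g0]
  [AddCommGroup g1] [Module k g1]

/-- Every nonzero odd vector of weight `γ` pairs nontrivially with some vector of weight `-γ`. -/
lemma InvForm.exists_oddSpace_neg {D : LieSuperData k g0 g1} (F : InvForm D)
    {t : LieSubalgebra k g0} {Γ : Set (Module.Dual k t)}
    (hg1 : (⨆ γ ∈ Γ, oddSpace D t γ) = ⊤) {γ : Module.Dual k t} {u : g1}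
    (hu : u ∈ oddSpace D t γ) (hu0 : u ≠ 0) :
    ∃ v ∈ oddSpace D t (-γ), F.B1 u v ≠ 0 := by
  by_contra! hcon
  refine hu0 (F.B1_nondeg u fun v => ?_)
  have hle : (⨆ δ ∈ Γ, oddSpace D t δ) ≤ LinearMap.ker (F.B1 u) := by
    refine iSup₂_le fun δ _ v hv => ?_
    rw [LinearMap.mem_ker]
    by_cases hδ : δ = -γ
    · exact hcon v (hδ ▸ hv)
    · by_contra hne
      refine hδ (LinearMap.ext fun H => ?_)
      have h1 := F.compat H u v
      rw [D.br_symm, F.compat, hu H, hv H, map_smul, map_smul, LinearMap.smul_apply,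
        LinearMap.smul_apply, F.B1_alt v u, smul_eq_mul, smul_eq_mul] at h1
      have h2 : (δ H + γ H) * F.B1 u v = 0 := by linear_combination -h1
      rw [LinearMap.neg_apply]
      exact eq_neg_of_add_eq_zero_left ((mul_eq_zero.mp h2).resolve_right hne)
  exact LinearMap.mem_ker.mp (hle (hg1 ▸ Submodule.mem_top))

/-- The negative of an even weight `α ≠ 0` with nonzero weight space has nonzero weight space. -/
lemma InvForm.evenSpace_neg_ne_bot {D : LieSuperData k g0 g1} (F : InvForm D)
    {t : LieSubalgebra k g0} {Φ : Set (Module.Dual k t)}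
    (hg0 : t.toSubmodule ⊔ (⨆ α ∈ Φ, evenSpace t α) = ⊤) [CharZero k]
    {α : Module.Dual k t} (hα : α ≠ 0) (hbot : evenSpace t α ≠ ⊥) :
    evenSpace t (-α) ≠ ⊥ := by
  obtain ⟨x, hx, hx0⟩ := Submodule.exists_mem_ne_zero_of_ne_bot hbot
  intro hneg
  refine hx0 (F.B0_nondeg x fun y => ?_)
  have key : ∀ H H' : t, α H' * F.B0 x H = -(α H * F.B0 x H') := by
    intro H H'
    have h := F.B0_invariant H' x H
    rw [hx H', ← lie_skew, hx H, map_smul, LinearMap.smul_apply, map_neg, map_smul,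
      smul_eq_mul, smul_eq_mul, F.B0_symm H' x] at h
    exact h
  have ht : t.toSubmodule ≤ LinearMap.ker (F.B0 x) := by
    intro H hH
    obtain ⟨H', hH'⟩ : ∃ H', α H' ≠ 0 := by
      by_contra! h
      exact hα (LinearMap.ext h)
    have h0 : F.B0 x H' = 0 := by
      have h := self_eq_neg.mp (key H' H')
      exact (mul_eq_zero.mp h).resolve_left hH'
    have h := key ⟨H, hH⟩ H'
    rw [h0, mul_zero, neg_zero] at h
    exact (mul_eq_zero.mp h).resolve_left hH'
  have hle : (⨆ δ ∈ Φ, evenSpace t δ) ≤ LinearMap.ker (F.B0 x) := by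
    refine iSup₂_le fun δ _ z hz => ?_
    rw [LinearMap.mem_ker]
    by_cases hδ : δ = -α
    · have hz0 : z = 0 := by rwa [hδ, hneg, Submodule.mem_bot] at hz
      rw [hz0, map_zero]
    · by_contra hne
      refine hδ (LinearMap.ext fun H => ?_)
      have h1 := F.B0_invariant x H z
      rw [← lie_skew, hx H, hz H, map_neg, LinearMap.neg_apply, map_smul, map_smul,
        LinearMap.smul_apply, smul_eq_mul, smul_eq_mul] at h1
      have h2 : (δ H + α H) * F.B0 x z = 0 := by linear_combination -h1
      rw [LinearMap.neg_apply]
      exact eq_neg_of_add_eq_zero_left ((mul_eq_zero.mp h2).resolve_right hne)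
  exact LinearMap.mem_ker.mp (sup_le ht hle (hg0 ▸ Submodule.mem_top))

/-- The odd bracket adds weights. -/
lemma LieSuperData.br_mem_evenSpace (D : LieSuperData k g0 g1) {t : LieSubalgebra k g0}
    {γ δ : Module.Dual k t} {u v : g1} (hu : u ∈ oddSpace D t γ) (hv : v ∈ oddSpace D t δ) :
    D.br u v ∈ evenSpace t (γ + δ) := by
  intro H
  rw [D.br_invariance, hu H, hv H, map_smul, map_smul, LinearMap.smul_apply,
    LinearMap.add_apply, add_smul]

/-- The action of `g₀` on `g₁` adds weights. -/
lemma LieSuperData.act_mem_oddSpace (D : LieSuperData k g0 g1) {t : LieSubalgebra k g0}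
    {α γ : Module.Dual k t} {x : g0} {u : g1} (hx : x ∈ evenSpace t α)
    (hu : u ∈ oddSpace D t γ) : D.act x u ∈ oddSpace D t (α + γ) := by
  intro H
  have h := D.act_lie H x u
  rw [hx H, hu H, map_smul, map_smul, LinearMap.smul_apply, eq_sub_iff_add_eq] at h
  rw [← h, LinearMap.add_apply, add_smul]

/-- The zero weight space of a self-normalizing subalgebra is contained in it. -/
lemma evenSpace_zero_le {t : LieSubalgebra k g0} (ht : t.normalizer = t) :
    evenSpace t 0 ≤ t.toSubmodule := by
  intro x hx
  rw [LieSubalgebra.mem_toSubmodule, ← ht, LieSubalgebra.mem_normalizer_iff']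
  intro H hH
  have h := hx ⟨H, hH⟩
  rw [LinearMap.zero_apply, zero_smul] at h
  rw [h]
  exact t.zero_mem

end

theorem stmt_11 {k g0 g1 : Type*} [Field k] [IsAlgClosed k] [CharZero k]
    [LieRing g0] [LieAlgebra k g0] [FiniteDimensional k g0]
    [AddCommGroup g1] [Module k g1] [FiniteDimensional k g1]
    (D : LieSuperData k g0 g1)
    (hred : LieAlgebra.radical k g0 = LieAlgebra.center k g0)
    (t : LieSubalgebra k g0) (hC : t.IsCartanSubalgebra)
    (Φ Γ : Set (Module.Dual k t))
    (hΦ : ∀ α : Module.Dual k t, α ∈ Φ ↔ (α ≠ 0 ∧ evenSpace t α ≠ ⊥))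
    (hΓ : ∀ γ : Module.Dual k t, γ ∈ Γ ↔ oddSpace D t γ ≠ ⊥)
    (hΓ0 : (0 : Module.Dual k t) ∉ Γ)
    (hdisj : Φ ∩ Γ = ∅)
    (hg0 : t.toSubmodule ⊔ (⨆ α ∈ Φ, evenSpace t α) = ⊤)
    (hg1 : (⨆ γ ∈ Γ, oddSpace D t γ) = ⊤)
    (F : InvForm D)
    (Hd : Module.Dual k t → t)
    (hHd : ∀ (θ : Module.Dual k t) (H : t), θ H = F.B0 (Hd θ : g0) (H : g0))
    (γ : Module.Dual k t) (hγ : γ ∈ Γ) (hiso : pairing F.B0 Hd γ γ = 0)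
    (β : Module.Dual k t) (hβ : β ∈ Φ ∪ Γ) (hp : pairing F.B0 Hd γ β ≠ 0) :
    γ + β ∈ Φ ∪ Γ ∨ γ - β ∈ Φ ∪ Γ := by
  obtain ⟨u, hu, hu0⟩ := Submodule.exists_mem_ne_zero_of_ne_bot ((hΓ γ).mp hγ)
  obtain ⟨v, hv, huv⟩ := F.exists_oddSpace_neg hg1 hu hu0
  have hpp : pairing F.B0 Hd γ β = γ (Hd β) := (hHd γ (Hd β)).symm
  have hiso' : γ (Hd γ) = 0 := (hHd γ (Hd γ)).trans hiso
  have hβγ : pairing F.B0 Hd γ β = β (Hd γ) := (F.B0_symm _ _).trans (hHd β (Hd γ)).symm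
  have hsum : γ + β ≠ 0 := by
    intro h
    apply hp
    rw [hβγ, eq_neg_of_add_eq_zero_right h, LinearMap.neg_apply, hiso', neg_zero]
  have hdiff : γ - β ≠ 0 := by
    intro h
    apply hp
    rw [hβγ, ← sub_eq_zero.mp h, hiso']
  have hT : D.br u v ∈ t := by
    have h := D.br_mem_evenSpace hu hv
    rw [add_neg_cancel] at h
    exact evenSpace_zero_le hC.self_normalizing h
  set T : t := ⟨D.br u v, hT⟩
  have hβT : β T ≠ 0 := by
    rw [hHd β T]
    change F.B0 (Hd β) (D.br u v) ≠ 0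
    rw [F.compat, hu, map_smul, LinearMap.smul_apply, smul_eq_mul, ← hpp]
    exact mul_ne_zero hp huv
  by_contra! hcon
  obtain ⟨hplus, hminus⟩ := hcon
  have hevenplus : evenSpace t (γ + β) = ⊥ := by
    by_contra h
    exact hplus (Or.inl ((hΦ _).mpr ⟨hsum, h⟩))
  have hoddplus : oddSpace D t (γ + β) = ⊥ := by
    by_contra h
    exact hplus (Or.inr ((hΓ _).mpr h))
  have hevenminus : evenSpace t (-γ + β) = ⊥ := by
    by_contra h
    have hne : -γ + β ≠ 0 := fun h0 => hdiff (by rw [← neg_eq_zero, ← h0]; abel)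
    have h' := F.evenSpace_neg_ne_bot hg0 hne h
    rw [show -(-γ + β) = γ - β by abel] at h'
    exact hminus (Or.inl ((hΦ _).mpr ⟨hdiff, h'⟩))
  have hoddminus : oddSpace D t (β + -γ) = ⊥ := by
    by_contra h
    obtain ⟨w, hw, hw0⟩ := Submodule.exists_mem_ne_zero_of_ne_bot h
    obtain ⟨z, hz, hwz⟩ := F.exists_oddSpace_neg hg1 hw hw0
    rw [show -(β + -γ) = γ - β by abel] at hz
    refine hminus (Or.inr ((hΓ _).mpr fun h0 => hwz ?_))
    rw [h0, Submodule.mem_bot] at hz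
    rw [hz, map_zero]
  rcases hβ with hβ | hβ
  · obtain ⟨x, hx, hx0⟩ := Submodule.exists_mem_ne_zero_of_ne_bot ((hΦ β).mp hβ).2
    have h1 := D.act_mem_oddSpace hx hu
    rw [add_comm, hoddplus, Submodule.mem_bot] at h1
    have h2 := D.act_mem_oddSpace hx hv
    rw [hoddminus, Submodule.mem_bot] at h2
    have h3 := D.br_invariance x u v
    rw [h1, h2, map_zero, map_zero, LinearMap.zero_apply, add_zero, ← lie_skew, neg_eq_zero] at h3
    exact smul_ne_zero hβT hx0 ((hx T).symm.trans h3)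
  · obtain ⟨x, hx, hx0⟩ := Submodule.exists_mem_ne_zero_of_ne_bot ((hΓ β).mp hβ)
    have h1 := D.br_mem_evenSpace hu hx
    rw [hevenplus, Submodule.mem_bot] at h1
    have h2 := D.br_mem_evenSpace hv hx
    rw [hevenminus, Submodule.mem_bot] at h2
    have h3 := D.super_jacobi u v x
    rw [D.br_symm x u, h1, h2, map_zero, LinearMap.zero_apply, LinearMap.zero_apply, add_zero,
      add_zero] at h3
    exact smul_ne_zero hβT hx0 ((hx T).symm.trans h3)
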